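/- For n ≥ 4, with g = e_2r_1e_0e_1e_2, the following equalities hold in Br(B_n): (i) (r_3r_2r_1r_0r_1r_2r_3)·g = g; (ii) e_0r_1r_2r_3·g = δ·e_0e_1e_3r_2r_3; (iii) e_0r_1·g = δ·e_0r_2r_1e_2; (iv) e_1r_2r_3·g = e_1e_0r_1r_2r_3e_2. -/

import Mathlib

/-- The ground ring `ℤ[δ, δ⁻¹]` of Laurent polynomials over `ℤ`. -/
abbrev Lp : Type := LaurentPolynomial ℤ

/-- The parameter `δ`. -/
noncomputable def δpar : Lp := LaurentPolynomial.T 1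

/-- Generators of the Brauer algebra of type `B_n`: `r i` and `e i` for `0 ≤ i ≤ n-1`. -/
inductive BGen (n : ℕ) : Type
  | r (i : Fin n) : BGen n
  | e (i : Fin n) : BGen n

/-- The generator `r i` viewed in the free algebra. -/
noncomputable def fr {n : ℕ} (i : Fin n) : FreeAlgebra Lp (BGen n) :=
  FreeAlgebra.ι Lp (BGen.r i)

/-- The generator `e i` viewed in the free algebra. -/
noncomputable def fe {n : ℕ} (i : Fin n) : FreeAlgebra Lp (BGen n) :=
  FreeAlgebra.ι Lp (BGen.e i)

/-- The defining relations of the Brauer algebra of type `B_n`. -/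
inductive BrauerBRel (n : ℕ) : FreeAlgebra Lp (BGen n) → FreeAlgebra Lp (BGen n) → Prop
  | rr (i : Fin n) : BrauerBRel n (fr i * fr i) 1
  | re (i : Fin n) : BrauerBRel n (fr i * fe i) (fe i)
  | er (i : Fin n) : BrauerBRel n (fe i * fr i) (fe i)
  | ee (i : Fin n) (h : 0 < i.val) : BrauerBRel n (fe i * fe i) (δpar • fe i)
  | e0e0 (i : Fin n) (h : i.val = 0) : BrauerBRel n (fe i * fe i) ((δpar * δpar) • fe i)
  | rrFar (i j : Fin n) (h : i.val + 2 ≤ j.val ∨ j.val + 2 ≤ i.val) :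
      BrauerBRel n (fr i * fr j) (fr j * fr i)
  | erFar (i j : Fin n) (h : i.val + 2 ≤ j.val ∨ j.val + 2 ≤ i.val) :
      BrauerBRel n (fe i * fr j) (fr j * fe i)
  | eeFar (i j : Fin n) (h : i.val + 2 ≤ j.val ∨ j.val + 2 ≤ i.val) :
      BrauerBRel n (fe i * fe j) (fe j * fe i)
  | braid (i j : Fin n) (h : i.val + 1 = j.val ∨ j.val + 1 = i.val)
      (hi : 0 < i.val) (hj : 0 < j.val) :
      BrauerBRel n (fr i * fr j * fr i) (fr j * fr i * fr j)
  | rre (i j : Fin n) (h : i.val + 1 = j.val ∨ j.val + 1 = i.val)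
      (hi : 0 < i.val) (hj : 0 < j.val) :
      BrauerBRel n (fr j * fr i * fe j) (fe i * fe j)
  | rer (i j : Fin n) (h : i.val + 1 = j.val ∨ j.val + 1 = i.val)
      (hi : 0 < i.val) (hj : 0 < j.val) :
      BrauerBRel n (fr i * fe j * fr i) (fr j * fe i * fr j)
  | b1010 (i j : Fin n) (h0 : i.val = 0) (h1 : j.val = 1) :
      BrauerBRel n (fr j * fr i * fr j * fr i) (fr i * fr j * fr i * fr j)
  | b_r0r1e0 (i j : Fin n) (h0 : i.val = 0) (h1 : j.val = 1) :
      BrauerBRel n (fr i * fr j * fe i) (fr j * fe i)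
  | b_r0e1r0e1 (i j : Fin n) (h0 : i.val = 0) (h1 : j.val = 1) :
      BrauerBRel n (fr i * fe j * fr i * fe j) (fe j * fe i * fe j)
  | b_r0r1r0e1 (i j : Fin n) (h0 : i.val = 0) (h1 : j.val = 1) :
      BrauerBRel n (fr i * fr j * fr i * fe j) (fe j * (fr i * fr j * fr i))
  | b_e0r1e0 (i j : Fin n) (h0 : i.val = 0) (h1 : j.val = 1) :
      BrauerBRel n (fe i * fr j * fe i) (δpar • fe i)
  | b_e0e1e0 (i j : Fin n) (h0 : i.val = 0) (h1 : j.val = 1) :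
      BrauerBRel n (fe i * fe j * fe i) (δpar • fe i)
  | b_e0r1r0 (i j : Fin n) (h0 : i.val = 0) (h1 : j.val = 1) :
      BrauerBRel n (fe i * fr j * fr i) (fe i * fr j)
  | b_e0e1r0 (i j : Fin n) (h0 : i.val = 0) (h1 : j.val = 1) :
      BrauerBRel n (fe i * fe j * fr i) (fe i * fe j)

/-- The Brauer algebra of type `B_n` over `ℤ[δ, δ⁻¹]`. -/
abbrev BrauerB (n : ℕ) : Type := RingQuot (BrauerBRel n)

/-- The generator `r i` of `Br(B_n)` (defined to be `1` for out-of-range indices). -/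
noncomputable def rb (n : ℕ) (i : ℕ) : BrauerB n :=
  if h : i < n then RingQuot.mkAlgHom Lp (BrauerBRel n) (fr ⟨i, h⟩) else 1

/-- The generator `e i` of `Br(B_n)` (defined to be `1` for out-of-range indices). -/
noncomputable def eb (n : ℕ) (i : ℕ) : BrauerB n :=
  if h : i < n then RingQuot.mkAlgHom Lp (BrauerBRel n) (fe ⟨i, h⟩) else 1

/-- A relation of `BrauerBRel n` becomes an equality in `Br(B_n)`. -/
theorem BrauerBRel.mkAlgHom_eq {n : ℕ} {x y : FreeAlgebra Lp (BGen n)} (h : BrauerBRel n x y) :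
    RingQuot.mkAlgHom Lp (BrauerBRel n) x = RingQuot.mkAlgHom Lp (BrauerBRel n) y :=
  RingQuot.mkAlgHom_rel Lp h

theorem δpar_smul_injective (n : ℕ) : Function.Injective fun x : BrauerB n => δpar • x := by
  intro x y h
  have hu : (LaurentPolynomial.T (-1) : Lp) * δpar = 1 := by
    rw [δpar, ← LaurentPolynomial.T_add, neg_add_cancel, LaurentPolynomial.T_zero]
  have hxy := congrArg (fun z => (LaurentPolynomial.T (-1) : Lp) • z) h
  simpa only [smul_smul, hu, one_smul] using hxy

theorem rb_mul_self (n i : ℕ) : rb n i * rb n i = 1 := by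
  by_cases h : i < n
  · simpa [rb, h] using (BrauerBRel.rr (n := n) ⟨i, h⟩).mkAlgHom_eq
  · simp [rb, h]

theorem rb_mul_self_mul (n i : ℕ) (x : BrauerB n) : rb n i * (rb n i * x) = x := by
  rw [← mul_assoc, rb_mul_self, one_mul]

theorem eb_mul_self {n i : ℕ} (hi : 0 < i) (h : i < n) : eb n i * eb n i = δpar • eb n i := by
  simpa [eb, h] using (BrauerBRel.ee (n := n) ⟨i, h⟩ hi).mkAlgHom_eq

theorem rb_comm (n i j : ℕ) (hij : i + 2 ≤ j ∨ j + 2 ≤ i) :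
    rb n i * rb n j = rb n j * rb n i := by
  by_cases hi : i < n
  · by_cases hj : j < n
    · simpa [rb, hi, hj] using (BrauerBRel.rrFar (n := n) ⟨i, hi⟩ ⟨j, hj⟩ hij).mkAlgHom_eq
    · simp [rb, hj]
  · simp [rb, hi]

theorem eb_rb_comm (n i j : ℕ) (hij : i + 2 ≤ j ∨ j + 2 ≤ i) :
    eb n i * rb n j = rb n j * eb n i := by
  by_cases hi : i < n
  · by_cases hj : j < n
    · simpa [rb, eb, hi, hj] using (BrauerBRel.erFar (n := n) ⟨i, hi⟩ ⟨j, hj⟩ hij).mkAlgHom_eq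
    · simp [rb, hj]
  · simp [eb, hi]

theorem eb_comm (n i j : ℕ) (hij : i + 2 ≤ j ∨ j + 2 ≤ i) :
    eb n i * eb n j = eb n j * eb n i := by
  by_cases hi : i < n
  · by_cases hj : j < n
    · simpa [eb, hi, hj] using (BrauerBRel.eeFar (n := n) ⟨i, hi⟩ ⟨j, hj⟩ hij).mkAlgHom_eq
    · simp [eb, hj]
  · simp [eb, hi]

theorem rb_rb_eb {n i j : ℕ} (hij : i + 1 = j ∨ j + 1 = i) (hi : 0 < i) (hj : 0 < j)
    (hin : i < n) (hjn : j < n) :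
    rb n j * rb n i * eb n j = eb n i * eb n j := by
  simpa [rb, eb, hin, hjn] using
    (BrauerBRel.rre (n := n) ⟨i, hin⟩ ⟨j, hjn⟩ hij hi hj).mkAlgHom_eq

theorem rb_eb_rb {n i j : ℕ} (hij : i + 1 = j ∨ j + 1 = i) (hi : 0 < i) (hj : 0 < j)
    (hin : i < n) (hjn : j < n) :
    rb n i * eb n j * rb n i = rb n j * eb n i * rb n j := by
  simpa [rb, eb, hin, hjn] using
    (BrauerBRel.rer (n := n) ⟨i, hin⟩ ⟨j, hjn⟩ hij hi hj).mkAlgHom_eq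

theorem rb_eb_eb {n i j : ℕ} (hij : i + 1 = j ∨ j + 1 = i) (hi : 0 < i) (hj : 0 < j)
    (hin : i < n) (hjn : j < n) :
    rb n j * eb n i * eb n j = rb n i * eb n j := by
  rw [mul_assoc, ← rb_rb_eb hij hi hj hin hjn, mul_assoc, rb_mul_self_mul]

theorem eb_rb_rb {n i j : ℕ} (hij : i + 1 = j ∨ j + 1 = i) (hi : 0 < i) (hj : 0 < j)
    (hin : i < n) (hjn : j < n) :
    eb n i * rb n j * rb n i = eb n i * eb n j := by
  have h : eb n i * eb n j = eb n i * (rb n j * rb n i) := by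
    calc eb n i * eb n j = rb n j * (rb n i * eb n j * rb n i) * rb n i := by
          rw [← rb_rb_eb hij hi hj hin hjn]
          simp only [mul_assoc, rb_mul_self, mul_one]
      _ = eb n i * (rb n j * rb n i) := by
          rw [rb_eb_rb hij hi hj hin hjn]
          simp only [mul_assoc, rb_mul_self_mul]
  rw [h, mul_assoc]

theorem eb_eb_rb {n i j : ℕ} (hij : i + 1 = j ∨ j + 1 = i) (hi : 0 < i) (hj : 0 < j)
    (hin : i < n) (hjn : j < n) :
    eb n i * eb n j * rb n i = eb n i * rb n j := by
  rw [← eb_rb_rb hij hi hj hin hjn, mul_assoc, rb_mul_self, mul_one]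

theorem eb_zero_eb_one_eb_zero {n : ℕ} (h : 1 < n) :
    eb n 0 * eb n 1 * eb n 0 = δpar • eb n 0 := by
  have h0 : 0 < n := by omega
  simpa [eb, h0, h] using (BrauerBRel.b_e0e1e0 (n := n) ⟨0, h0⟩ ⟨1, h⟩ rfl rfl).mkAlgHom_eq

/-- The mirror image of the defining relation `e₀e₁r₀ = e₀e₁`. -/
theorem rb_zero_eb_one_eb_zero {n : ℕ} (h : 1 < n) :
    rb n 0 * eb n 1 * eb n 0 = eb n 1 * eb n 0 := by
  have h0 : 0 < n := by omega
  have hX : rb n 0 * eb n 1 * rb n 0 * eb n 1 = eb n 1 * eb n 0 * eb n 1 := by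
    simpa [rb, eb, h0, h] using
      (BrauerBRel.b_r0e1r0e1 (n := n) ⟨0, h0⟩ ⟨1, h⟩ rfl rfl).mkAlgHom_eq
  have hr : eb n 0 * eb n 1 * rb n 0 = eb n 0 * eb n 1 := by
    simpa [rb, eb, h0, h] using
      (BrauerBRel.b_e0e1r0 (n := n) ⟨0, h0⟩ ⟨1, h⟩ rfl rfl).mkAlgHom_eq
  have hY : eb n 1 * rb n 0 * eb n 1 = rb n 0 * (eb n 1 * eb n 0 * eb n 1) := by
    rw [← hX]
    simp only [mul_assoc, rb_mul_self_mul]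
  have hYr : eb n 1 * rb n 0 * eb n 1 * rb n 0 = eb n 1 * rb n 0 * eb n 1 := by
    rw [hY]
    simp only [mul_assoc] at hr ⊢
    rw [hr]
  have hXY : eb n 1 * eb n 0 * eb n 1 = eb n 1 * rb n 0 * eb n 1 := by
    apply δpar_smul_injective n
    change δpar • _ = δpar • _
    calc δpar • (eb n 1 * eb n 0 * eb n 1)
        = eb n 1 * (eb n 1 * eb n 0 * eb n 1) := by
          simp only [← mul_assoc, eb_mul_self one_pos h, smul_mul_assoc]
      _ = (eb n 1 * rb n 0 * eb n 1 * rb n 0) * eb n 1 := by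
          rw [← hX]
          simp only [mul_assoc]
      _ = δpar • (eb n 1 * rb n 0 * eb n 1) := by
          rw [hYr]
          simp only [mul_assoc, eb_mul_self one_pos h, mul_smul_comm]
  have hδ : eb n 1 * eb n 0 * eb n 1 * eb n 0 = δpar • (eb n 1 * eb n 0) := by
    rw [mul_assoc (eb n 1), mul_assoc (eb n 1), eb_zero_eb_one_eb_zero h, mul_smul_comm]
  apply δpar_smul_injective n
  change δpar • _ = δpar • _
  rw [mul_assoc, ← mul_smul_comm, ← hδ, ← mul_assoc, ← hY, hXY]

/-- An expression for `e₂r₁e₀e₁e₂` that begins with `r₁r₂e₁e₀`. -/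
theorem eb_two_rb_one_eb_zero_eb_one_eb_two {n : ℕ} (h : 2 < n) :
    eb n 2 * rb n 1 * eb n 0 * eb n 1 * eb n 2 =
      rb n 1 * rb n 2 * (eb n 1 * eb n 0) * rb n 1 * eb n 2 := by
  have h1 : 1 < n := by omega
  calc eb n 2 * rb n 1 * eb n 0 * eb n 1 * eb n 2
      = rb n 1 * (rb n 1 * eb n 2 * rb n 1) * (eb n 0 * eb n 1 * eb n 2) := by
        simp only [mul_assoc, rb_mul_self_mul]
    _ = rb n 1 * rb n 2 * eb n 1 * (eb n 0 * rb n 2) * eb n 1 * eb n 2 := by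
        rw [rb_eb_rb (by omega) (by omega) (by omega) h1 h, eb_rb_comm n 0 2 (by omega)]
        simp only [mul_assoc]
    _ = rb n 1 * rb n 2 * (eb n 1 * eb n 0) * (rb n 2 * eb n 1 * eb n 2) := by
        simp only [mul_assoc]
    _ = _ := by
        rw [rb_eb_eb (by omega) (by omega) (by omega) h1 h]
        simp only [mul_assoc]

/-- The elements `r₁r₀r₁` and `e₂r₁e₀e₁e₂` satisfy `r₁r₀r₁ · e₂r₁e₀e₁e₂ = e₂r₁e₀e₁e₂`. -/
theorem rb_one_rb_zero_rb_one_mul {n : ℕ} (h : 2 < n) :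
    rb n 1 * rb n 0 * rb n 1 * (eb n 2 * rb n 1 * eb n 0 * eb n 1 * eb n 2) =
      eb n 2 * rb n 1 * eb n 0 * eb n 1 * eb n 2 := by
  rw [eb_two_rb_one_eb_zero_eb_one_eb_two h]
  calc rb n 1 * rb n 0 * rb n 1 *
        (rb n 1 * rb n 2 * (eb n 1 * eb n 0) * rb n 1 * eb n 2)
      = rb n 1 * (rb n 0 * rb n 2) * (eb n 1 * eb n 0) * rb n 1 * eb n 2 := by
        simp only [mul_assoc, rb_mul_self_mul]
    _ = rb n 1 * rb n 2 * (rb n 0 * eb n 1 * eb n 0) * rb n 1 * eb n 2 := by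
        rw [rb_comm n 0 2 (by omega)]
        simp only [mul_assoc]
    _ = _ := by
        rw [rb_zero_eb_one_eb_zero (by omega)]

theorem rb_two_rb_three_eb_two_mul {n : ℕ} (h : 3 < n) (x : BrauerB n) :
    rb n 2 * (rb n 3 * (eb n 2 * x)) = eb n 3 * (eb n 2 * x) := by
  simp only [← mul_assoc]
  rw [rb_rb_eb (by omega) (by omega) (by omega) h (by omega)]

/-- The equality `e₀r₁ · e₂r₁e₀e₁e₂ = δ·e₀e₁e₂`. -/
theorem eb_zero_rb_one_mul {n : ℕ} (h : 2 < n) :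
    eb n 0 * rb n 1 * (eb n 2 * rb n 1 * eb n 0 * eb n 1 * eb n 2) =
      δpar • (eb n 0 * eb n 1 * eb n 2) := by
  have h1 : 1 < n := by omega
  rw [eb_two_rb_one_eb_zero_eb_one_eb_two h]
  calc eb n 0 * rb n 1 * (rb n 1 * rb n 2 * (eb n 1 * eb n 0) * rb n 1 * eb n 2)
      = (eb n 0 * rb n 2) * eb n 1 * eb n 0 * rb n 1 * eb n 2 := by
        simp only [mul_assoc, rb_mul_self_mul]
    _ = rb n 2 * (eb n 0 * eb n 1 * eb n 0) * rb n 1 * eb n 2 := by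
        rw [eb_rb_comm n 0 2 (by omega)]
        simp only [mul_assoc]
    _ = δpar • ((rb n 2 * eb n 0) * rb n 1 * eb n 2) := by
        rw [eb_zero_eb_one_eb_zero h1]
        simp only [mul_smul_comm, smul_mul_assoc]
    _ = δpar • (eb n 0 * (rb n 2 * rb n 1 * eb n 2)) := by
        rw [← eb_rb_comm n 0 2 (by omega)]
        simp only [mul_assoc]
    _ = _ := by
        rw [rb_rb_eb (by omega) (by omega) (by omega) h1 h, mul_assoc]

/-- For `n ≥ 4`, with `g = e₂r₁e₀e₁e₂` in `Br(B_n)`: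
(i) `(r₃r₂r₁r₀r₁r₂r₃)·g = g`; (ii) `e₀r₁r₂r₃·g = δ·e₀e₁e₃r₂r₃`;
(iii) `e₀r₁·g = δ·e₀r₂r₁e₂`; (iv) `e₁r₂r₃·g = e₁e₀r₁r₂r₃e₂`. -/
theorem statement_10 (n : ℕ) (hn : 4 ≤ n) :
    (rb n 3 * rb n 2 * rb n 1 * rb n 0 * rb n 1 * rb n 2 * rb n 3 *
        (eb n 2 * rb n 1 * eb n 0 * eb n 1 * eb n 2) =
      eb n 2 * rb n 1 * eb n 0 * eb n 1 * eb n 2) ∧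
    (eb n 0 * rb n 1 * rb n 2 * rb n 3 * (eb n 2 * rb n 1 * eb n 0 * eb n 1 * eb n 2) =
      δpar • (eb n 0 * eb n 1 * eb n 3 * rb n 2 * rb n 3)) ∧
    (eb n 0 * rb n 1 * (eb n 2 * rb n 1 * eb n 0 * eb n 1 * eb n 2) =
      δpar • (eb n 0 * rb n 2 * rb n 1 * eb n 2)) ∧
    (eb n 1 * rb n 2 * rb n 3 * (eb n 2 * rb n 1 * eb n 0 * eb n 1 * eb n 2) =
      eb n 1 * eb n 0 * rb n 1 * rb n 2 * rb n 3 * eb n 2) := by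
  have h2 : 2 < n := by omega
  have h1 : 1 < n := by omega
  refine ⟨?_, ?_, ?_, ?_⟩
  · calc rb n 3 * rb n 2 * rb n 1 * rb n 0 * rb n 1 * rb n 2 * rb n 3 *
          (eb n 2 * rb n 1 * eb n 0 * eb n 1 * eb n 2)
        = rb n 3 * rb n 2 * rb n 1 * rb n 0 * (rb n 1 * eb n 3) *
          (eb n 2 * rb n 1 * eb n 0 * eb n 1 * eb n 2) := by
          simp only [mul_assoc, rb_two_rb_three_eb_two_mul hn]
      _ = rb n 3 * rb n 2 * rb n 1 * (rb n 0 * eb n 3) * rb n 1 *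
          (eb n 2 * rb n 1 * eb n 0 * eb n 1 * eb n 2) := by
          rw [← eb_rb_comm n 3 1 (by omega)]
          simp only [mul_assoc]
      _ = rb n 3 * rb n 2 * (rb n 1 * eb n 3) * rb n 0 * rb n 1 *
          (eb n 2 * rb n 1 * eb n 0 * eb n 1 * eb n 2) := by
          rw [← eb_rb_comm n 3 0 (by omega)]
          simp only [mul_assoc]
      _ = rb n 3 * rb n 2 * eb n 3 * (rb n 1 * rb n 0 * rb n 1 *
          (eb n 2 * rb n 1 * eb n 0 * eb n 1 * eb n 2)) := by
          rw [← eb_rb_comm n 3 1 (by omega)]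
          simp only [mul_assoc]
      _ = _ := by
          rw [rb_one_rb_zero_rb_one_mul h2]
          simp only [mul_assoc, ← rb_two_rb_three_eb_two_mul hn, rb_mul_self_mul]
  · calc eb n 0 * rb n 1 * rb n 2 * rb n 3 * (eb n 2 * rb n 1 * eb n 0 * eb n 1 * eb n 2)
        = eb n 0 * (rb n 1 * eb n 3) * (eb n 2 * rb n 1 * eb n 0 * eb n 1 * eb n 2) := by
          simp only [mul_assoc, rb_two_rb_three_eb_two_mul hn]
      _ = (eb n 0 * eb n 3) * rb n 1 * (eb n 2 * rb n 1 * eb n 0 * eb n 1 * eb n 2) := by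
          rw [← eb_rb_comm n 3 1 (by omega)]
          simp only [mul_assoc]
      _ = eb n 3 * (eb n 0 * rb n 1 * (eb n 2 * rb n 1 * eb n 0 * eb n 1 * eb n 2)) := by
          rw [eb_comm n 0 3 (by omega)]
          simp only [mul_assoc]
      _ = δpar • ((eb n 3 * eb n 0) * eb n 1 * eb n 2) := by
          rw [eb_zero_rb_one_mul h2, mul_smul_comm]
          simp only [mul_assoc]
      _ = δpar • (eb n 0 * (eb n 3 * eb n 1) * eb n 2) := by
          rw [eb_comm n 3 0 (by omega)]
          simp only [mul_assoc]
      _ = δpar • (eb n 0 * eb n 1 * (eb n 3 * eb n 2)) := by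
          rw [eb_comm n 3 1 (by omega)]
          simp only [mul_assoc]
      _ = _ := by
          rw [← eb_rb_rb (by omega) (by omega) (by omega) hn h2]
          simp only [mul_assoc]
  · rw [eb_zero_rb_one_mul h2, mul_assoc, ← rb_rb_eb (by omega) (by omega) (by omega) h1 h2]
    simp only [mul_assoc]
  · calc eb n 1 * rb n 2 * rb n 3 * (eb n 2 * rb n 1 * eb n 0 * eb n 1 * eb n 2)
        = (eb n 1 * eb n 3) * (eb n 2 * rb n 1 * eb n 0 * eb n 1 * eb n 2) := by
          simp only [mul_assoc, rb_two_rb_three_eb_two_mul hn]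
      _ = eb n 3 * (eb n 1 * eb n 2 * rb n 1) * eb n 0 * eb n 1 * eb n 2 := by
          rw [eb_comm n 1 3 (by omega)]
          simp only [mul_assoc]
      _ = eb n 3 * eb n 1 * (rb n 2 * eb n 0) * eb n 1 * eb n 2 := by
          rw [eb_eb_rb (by omega) (by omega) (by omega) h1 h2]
          simp only [mul_assoc]
      _ = eb n 3 * eb n 1 * eb n 0 * (rb n 2 * eb n 1 * eb n 2) := by
          rw [← eb_rb_comm n 0 2 (by omega)]
          simp only [mul_assoc]
      _ = (eb n 3 * eb n 1) * eb n 0 * rb n 1 * eb n 2 := by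
          rw [rb_eb_eb (by omega) (by omega) (by omega) h1 h2]
          simp only [mul_assoc]
      _ = eb n 1 * (eb n 3 * eb n 0) * rb n 1 * eb n 2 := by
          rw [eb_comm n 3 1 (by omega)]
          simp only [mul_assoc]
      _ = eb n 1 * eb n 0 * (eb n 3 * rb n 1) * eb n 2 := by
          rw [eb_comm n 3 0 (by omega)]
          simp only [mul_assoc]
      _ = eb n 1 * eb n 0 * rb n 1 * (eb n 3 * eb n 2) := by
          rw [eb_rb_comm n 3 1 (by omega)]
          simp only [mul_assoc]
      _ = _ := by
          rw [← rb_rb_eb (by omega) (by omega) (by omega) hn h2]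
          simp only [mul_assoc]
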